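/- arXiv:1406.0263 — 3 statements merged into one kernel-verified Lean document; each statement's English description precedes it below -/
import Mathlib

section
/- Let r = (i,j,p) be a run in a string w of length n. Then there is a unique ℓ ∈ {0,1} such that ŵ[j+1] ≺_ℓ ŵ[j+1−p], and for this ℓ, every L-root [iλ..jλ] of r with respect to ≺_ℓ satisfies [iλ..jλ] = λ_ℓ(iλ), i.e., ŵ[iλ..jλ] is the longest Lyndon word with respect to ≺_ℓ starting at position iλ in ŵ. -/
variable {α : Type*}

/-- The substring `w[i..j]` of a 1-indexed string given as a function `w : ℕ → α`. -/
def substr (w : ℕ → α) (i j : ℕ) : List α :=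
  (List.range (j + 1 - i)).map (fun k => w (i + k))

/-- `u` is a Lyndon word w.r.t. the strict order `lt`:
`u` is nonempty and lexicographically smaller than each of its nonempty proper suffixes. -/
def IsLyndon (lt : α → α → Prop) (u : List α) : Prop :=
  u ≠ [] ∧ ∀ v, v ≠ [] → v ≠ u → v <:+ u → List.Lex lt u v

/-- `p` is a period of the substring `w[i..j]`. -/
def IsPeriod (w : ℕ → α) (i j p : ℕ) : Prop :=
  ∀ k, i ≤ k → k + p ≤ j → w k = w (k + p)

/-- `(i,j,p)` is a run of the string `w[1..n]`. -/
def IsRun (w : ℕ → α) (n i j p : ℕ) : Prop :=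
  1 ≤ i ∧ j ≤ n ∧ 1 ≤ p ∧ i + 2 * p ≤ j + 1 ∧
  IsPeriod w i j p ∧ (∀ q, 1 ≤ q → q < p → ¬ IsPeriod w i j q) ∧
  (i = 1 ∨ w (i - 1) ≠ w (i + p - 1)) ∧
  (j = n ∨ w (j + 1) ≠ w (j - p + 1))

/-- The set of runs of the string `w[1..n]`, as triples `(i,j,p)`. -/
def Runs (w : ℕ → α) (n : ℕ) : Set (ℕ × ℕ × ℕ) :=
  { r | IsRun w n r.1 r.2.1 r.2.2 }

/-- The exponent of a run `(i,j,p)`, i.e. `(j-i+1)/p`, as a rational number. -/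
def expo (r : ℕ × ℕ × ℕ) : ℚ :=
  ((r.2.1 : ℚ) - (r.1 : ℚ) + 1) / (r.2.2 : ℚ)

/-- `ŵ = w$`: positions `1..n` carry `w`, position `n+1` carries the sentinel `none`. -/
def hat (w : ℕ → α) (n : ℕ) : ℕ → Option α :=
  fun i => if i ≤ n then some (w i) else none

/-- Extension of a strict order `lt` on `α` to `Option α`, where the sentinel `none`
is smaller than every letter if `small = true`, and larger otherwise. -/
def extLT (small : Bool) (lt : α → α → Prop) : Option α → Option α → Prop
  | none, none => False
  | none, some _ => small = true
  | some _, none => small = false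
  | some a, some b => lt a b

/-- The order `≺_ℓ` on `Σ ∪ {$}` (for `ℓ ∈ {0,1}` encoded as `Bool`):
`$ ≺₀ a` and `a ≺₁ $` for every `a ∈ Σ`. -/
def hatOrd (lt0 lt1 : α → α → Prop) (ℓ : Bool) : Option α → Option α → Prop :=
  extLT (!ℓ) (cond ℓ lt1 lt0)

/-- `[i..j] = λ_ℓ(i)`: `ŵ[i..j]` is the longest Lyndon word (w.r.t. `lt`)
starting at position `i` in `ŵ = ŵ[1..n+1]`. -/
def IsLongestLyndon (lt : Option α → Option α → Prop) (what : ℕ → Option α)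
    (n i j : ℕ) : Prop :=
  i ≤ j ∧ j ≤ n + 1 ∧ IsLyndon lt (substr what i j) ∧
  ∀ j', j < j' → j' ≤ n + 1 → ¬ IsLyndon lt (substr what i j')

/-- `[iℓ..jℓ]` is an L-root of the run `(i,j,p)` w.r.t. `lt`. -/
def IsLRoot (lt : α → α → Prop) (w : ℕ → α) (i j p iℓ jℓ : ℕ) : Prop :=
  i ≤ iℓ ∧ jℓ ≤ j ∧ jℓ + 1 = iℓ + p ∧ IsLyndon lt (substr w iℓ jℓ)

/-- The set `B_r` for the run `r = (i,j,p)` of `w[1..n]`: all L-roots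
(as intervals, i.e. pairs `(iλ, jλ)`) of `r` w.r.t. the unique order `≺_ℓ`
with `ŵ[j+1] ≺_ℓ ŵ[j+1-p]`, except those starting at `i`. -/
def Br (lt0 lt1 : α → α → Prop) (w : ℕ → α) (n i j p : ℕ) : Set (ℕ × ℕ) :=
  { q | ∃ ℓ : Bool, hatOrd lt0 lt1 ℓ (hat w n (j + 1)) (hat w n (j + 1 - p)) ∧
        IsLRoot (cond ℓ lt1 lt0) w i j p q.1 q.2 ∧ q.1 ≠ i }

/-- `p` is a period of the list `s` (0-indexed form of `s[k] = s[k+p]` for `1 ≤ k ≤ |s|-p`). -/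
def ListPeriod (s : List α) (p : ℕ) : Prop :=
  ∀ k, k + p < s.length → s[k]? = s[k + p]?

theorem substr_getElem? {β : Type*} (x : ℕ → β) (i j m : ℕ) :
    (substr x i j)[m]? = if i + m ≤ j then some (x (i + m)) else none := by
  unfold substr
  split_ifs with h
  · rw [List.getElem?_map, List.getElem?_range (by omega)]
    rfl
  · rw [List.getElem?_eq_none_iff]
    simp only [List.length_map, List.length_range]
    omega

theorem substr_length {β : Type*} (x : ℕ → β) (i j : ℕ) :
    (substr x i j).length = j + 1 - i := by
  simp [substr]

theorem substr_add_suffix {β : Type*} (x : ℕ → β) (i j p : ℕ) :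
    substr x (i + p) j <:+ substr x i j := by
  have h : substr x (i + p) j = (substr x i j).drop p := by
    ext1 m
    rw [List.getElem?_drop, substr_getElem?, substr_getElem?, add_assoc]
  rw [h]
  exact List.drop_suffix _ _

theorem substr_hat {β : Type*} (w : ℕ → β) (n i j : ℕ) (hj : j ≤ n) :
    substr (hat w n) i j = (substr w i j).map some := by
  ext1 m
  rw [List.getElem?_map, substr_getElem?, substr_getElem?]
  split_ifs with h
  · simp [hat, h.trans hj]
  · rfl

/-- If `v` first differs from `u` at index `k`, either by ending there or by carrying a letter
that is not larger, then `u` is not lexicographically smaller than `v`. -/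
theorem not_lex_of_agree {β : Type*} {lt : β → β → Prop} (hirr : ∀ a, ¬ lt a a) (k : ℕ) :
    ∀ u v : List β, (∀ m < k, u[m]? = v[m]?) →
      (v[k]? = none ∨ ∃ a b, u[k]? = some a ∧ v[k]? = some b ∧ a ≠ b ∧ ¬ lt a b) →
      ¬ List.Lex lt u v := by
  induction k with
  | zero =>
    rintro u v - (h | ⟨a, b, hu, hv, hne, hlt⟩) hlex
    · cases hlex <;> simp at h
    · cases hlex with
      | nil => simp at hu
      | cons h => simp_all
      | rel h => simp_all
  | succ k ih =>
    intro u v hagree hk hlex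
    have h0 := hagree 0 k.succ_pos
    cases hlex with
    | nil => simp at h0
    | cons h =>
      refine ih _ _ (fun m hm => ?_) (by simpa using hk) h
      simpa using hagree (m + 1) (by omega)
    | rel h =>
      simp only [List.getElem?_cons_zero, Option.some.injEq] at h0
      exact hirr _ (h0 ▸ h)

theorem List.Lex.map_of_imp {β γ : Type*} {r : β → β → Prop} {s : γ → γ → Prop} (f : β → γ)
    (hf : ∀ a b, r a b → s (f a) (f b)) {u v : List β} (h : List.Lex r u v) :
    List.Lex s (u.map f) (v.map f) := by
  induction h with
  | nil => exact List.Lex.nil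
  | cons _ ih => exact List.Lex.cons ih
  | rel h => exact List.Lex.rel (hf _ _ h)

theorem IsLyndon.map {β γ : Type*} {r : β → β → Prop} {s : γ → γ → Prop} (f : β → γ)
    (hf : ∀ a b, r a b → s (f a) (f b)) {u : List β} (h : IsLyndon r u) :
    IsLyndon s (u.map f) := by
  refine ⟨by simpa using h.1, ?_⟩
  intro v hv hne hsuf
  obtain ⟨t, ht⟩ := hsuf
  obtain ⟨u₁, u₂, rfl, rfl, rfl⟩ := List.map_eq_append_iff.1 ht.symm
  refine List.Lex.map_of_imp f hf (h.2 u₂ ?_ ?_ (List.suffix_append _ _))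
  · rintro rfl
    exact hv rfl
  · intro h'
    exact hne (congrArg (List.map f) h')

theorem hatOrd_asymm {β : Type*} {lt0 lt1 : β → β → Prop} [IsStrictTotalOrder β lt0]
    (hopp : ∀ a b : β, lt0 a b ↔ lt1 b a) (ℓ : Bool) (a b : Option β)
    (h : hatOrd lt0 lt1 ℓ a b) : ¬ hatOrd lt0 lt1 ℓ b a := by
  have has : ∀ a b : β, lt0 a b → ¬ lt0 b a := fun _ _ h h' => asymm h h'
  cases ℓ <;> cases a <;> cases b <;> simp_all [hatOrd, extLT]

theorem existsUnique_hatOrd {β : Type*} {lt0 lt1 : β → β → Prop} [IsStrictTotalOrder β lt0]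
    (hopp : ∀ a b : β, lt0 a b ↔ lt1 b a) {a b : Option β} (hne : a ≠ b) :
    ∃! ℓ : Bool, hatOrd lt0 lt1 ℓ a b := by
  have has : ∀ a b : β, lt0 a b → ¬ lt0 b a := fun _ _ h h' => asymm h h'
  cases a with
  | none =>
    cases b with
    | none => exact absurd rfl hne
    | some b => exact ⟨false, by simp [hatOrd, extLT], by simp [hatOrd, extLT]⟩
  | some a =>
    cases b with
    | none => exact ⟨true, by simp [hatOrd, extLT], by simp [hatOrd, extLT]⟩
    | some b =>
      rcases trichotomous_of lt0 a b with h | h | h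
      · exact ⟨false, by simpa [hatOrd, extLT] using h,
          by simpa [hatOrd, extLT, ← hopp] using has _ _ h⟩
      · exact absurd (congrArg some h) hne
      · exact ⟨true, by simpa [hatOrd, extLT, ← hopp] using h,
          by simpa [hatOrd, extLT, ← hopp] using has _ _ h⟩

/-- A string that starts inside a `p`-periodic stretch ending at `j`, is longer than `p`, and
whose periodicity (if it reaches `j + 1`) is broken by a smaller letter, is not Lyndon. -/
theorem not_isLyndon_of_isPeriod {β : Type*} {lt : β → β → Prop}
    (hasymm : ∀ a b, lt a b → ¬ lt b a) {x : ℕ → β} {i j p s t : ℕ} (hp : 1 ≤ p)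
    (hper : IsPeriod x i j p) (hlt : lt (x (j + 1)) (x (j + 1 - p)))
    (his : i ≤ s) (hsj : s + p ≤ j + 1) (hst : s + p ≤ t) :
    ¬ IsLyndon lt (substr x s t) := by
  have hirr : ∀ a, ¬ lt a a := fun a h => hasymm a a h h
  intro hlyn
  have hlex := hlyn.2 (substr x (s + p) t)
    (fun h => by have := congrArg List.length h; simp [substr_length] at this; omega)
    (fun h => by have := congrArg List.length h; simp [substr_length] at this; omega)
    (substr_add_suffix x s t p)
  have hagree : ∀ m, s + p + m ≤ j → s + p + m ≤ t →
      (substr x s t)[m]? = (substr x (s + p) t)[m]? := by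
    intro m hmj hmt
    rw [substr_getElem?, substr_getElem?, if_pos (by omega), if_pos hmt,
      hper (s + m) (by omega) (by omega), add_right_comm]
  by_cases htj : t ≤ j
  · refine not_lex_of_agree hirr (t + 1 - (s + p)) _ _
      (fun m hm => hagree m (by omega) (by omega)) (Or.inl ?_) hlex
    rw [substr_getElem?, if_neg (by omega)]
  · refine not_lex_of_agree hirr (j + 1 - (s + p)) _ _
      (fun m hm => hagree m (by omega) (by omega))
      (Or.inr ⟨x (j + 1 - p), x (j + 1), ?_, ?_, ?_, hasymm _ _ hlt⟩) hlex
    · rw [substr_getElem?, if_pos (by omega)]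
      congr 2
      omega
    · rw [substr_getElem?, if_pos (by omega)]
      congr 2
      omega
    · intro h
      rw [h] at hlt
      exact hirr _ hlt

theorem runs_stmt1 {α : Type*} (lt0 lt1 : α → α → Prop)
    [IsStrictTotalOrder α lt0]
    (hopp : ∀ a b : α, lt0 a b ↔ lt1 b a)
    (n : ℕ) (w : ℕ → α) (i j p : ℕ) (hrun : IsRun w n i j p) :
    (∃! ℓ : Bool, hatOrd lt0 lt1 ℓ (hat w n (j + 1)) (hat w n (j + 1 - p))) ∧
    (∀ ℓ : Bool, hatOrd lt0 lt1 ℓ (hat w n (j + 1)) (hat w n (j + 1 - p)) →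
      ∀ iℓ jℓ, IsLRoot (cond ℓ lt1 lt0) w i j p iℓ jℓ →
        IsLongestLyndon (hatOrd lt0 lt1 ℓ) (hat w n) n iℓ jℓ) := by
  obtain ⟨_, hjn, hp, hlen, hper, -, -, hmax⟩ := hrun
  have hper' : IsPeriod (hat w n) i j p := by
    intro k hik hkj
    have hk : k ≤ n := by omega
    have hkp : k + p ≤ n := by omega
    simp only [hat, if_pos hk, if_pos hkp, hper k hik hkj]
  constructor
  · apply existsUnique_hatOrd hopp
    have hjp : j + 1 - p ≤ n := by omega
    by_cases hj : j = n
    · simp [hat, hj, show n + 1 - p ≤ n by omega]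
    · have hj1 : j + 1 ≤ n := by omega
      have hne := hmax.resolve_left hj
      rw [show j - p + 1 = j + 1 - p by omega] at hne
      simpa [hat, hj1, hjp] using hne
  · rintro ℓ hℓ iℓ jℓ ⟨hi, hj, hpe, hlyn⟩
    refine ⟨by omega, by omega, ?_, fun j' hj' _ => ?_⟩
    · rw [substr_hat w n iℓ jℓ (hj.trans hjn)]
      exact hlyn.map some (fun _ _ h => h)
    · exact not_isLyndon_of_isPeriod (hatOrd_asymm hopp ℓ) hp hper' hℓ hi (by omega) (by omega)
end

section
/- For any string w of length n, position 1 does not belong to Beg(B_r) for any run r of w, and consequently the sum over all runs r of w of |B_r| is at most n − 1. -/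
variable {α : Type*}

theorem exists_mismatch_of_lex {lt : α → α → Prop} {u v : List α} (h : List.Lex lt u v)
    (hlen : v.length ≤ u.length) :
    ∃ (t : ℕ) (a b : α), u[t]? = some a ∧ v[t]? = some b ∧ lt a b ∧ ∀ x < t, u[x]? = v[x]? := by
  induction h with
  | nil => simp at hlen
  | @rel a u b v hab => exact ⟨0, a, b, by simp, by simp, hab, by simp⟩
  | @cons a u v _ ih =>
    obtain ⟨t, b, c, hb, hc, hbc, heq⟩ := ih (by simpa using hlen)
    refine ⟨t + 1, b, c, by simpa using hb, by simpa using hc, hbc, fun x hx => ?_⟩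
    cases x with
    | zero => simp
    | succ x => simpa using heq x (by omega)

theorem getElem?_substr (w : ℕ → α) (i j x : ℕ) :
    (substr w i j)[x]? = if x < j + 1 - i then some (w (i + x)) else none := by
  unfold substr
  split_ifs with h
  · simp [h]
  · simp; omega

/-- A Lyndon substring is separated from each of its proper suffixes by a first mismatch. -/
theorem IsLyndon.exists_mismatch {lt : α → α → Prop} {w : ℕ → α} {k e p : ℕ}
    (hkp : e + 1 = k + p) (h : IsLyndon lt (substr w k e)) {d : ℕ} (hd : 0 < d) (hdp : d < p) :
    ∃ t, d + t < p ∧ (∀ x < t, w (k + x) = w (k + d + x)) ∧ lt (w (k + t)) (w (k + d + t)) := by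
  have hlen : (substr w k e).length = p := by simp [substr]; omega
  have hne : ((substr w k e).drop d).length = p - d := by simp [hlen]
  have hlex := h.2 ((substr w k e).drop d)
    (by intro h0; simp [h0] at hne; omega)
    (by intro h0; rw [h0] at hne; omega)
    (List.drop_suffix _ _)
  obtain ⟨t, a, b, ha, hb, hab, heq⟩ := exists_mismatch_of_lex hlex (by omega)
  have ht : d + t < p := by
    have := (List.getElem?_eq_some_iff.1 hb).1
    omega
  simp only [List.getElem?_drop, getElem?_substr] at ha hb heq
  rw [if_pos (by omega), Option.some_inj] at ha hb
  refine ⟨t, ht, fun x hx => ?_, ?_⟩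
  · have := heq x hx
    rw [if_pos (by omega), if_pos (by omega), Option.some_inj] at this
    rw [this, add_assoc]
  · rw [ha, add_assoc, hb]
    exact hab

/-- Two runs of the same period `p` coincide if both contain a common segment of length `p`
and start strictly before it. -/
theorem IsRun.eq_of_period_eq {w : ℕ → α} {n i j i' j' p k : ℕ} (h : IsRun w n i j p)
    (h' : IsRun w n i' j' p) (hk : i < k) (hk' : i' < k) (hj : k + p ≤ j + 1)
    (hj' : k + p ≤ j' + 1) : i = i' ∧ j = j' := by
  obtain ⟨hi1, hjn, hp, -, hper, -, hl, hr⟩ := h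
  obtain ⟨hi1', hjn', -, -, hper', -, hl', hr'⟩ := h'
  constructor
  · rcases lt_trichotomy i i' with hlt | heq | hlt
    · refine absurd (hper (i' - 1) (by omega) (by omega)) ?_
      rw [show i' - 1 + p = i' + p - 1 by omega]
      exact hl'.resolve_left (by omega)
    · exact heq
    · refine absurd (hper' (i - 1) (by omega) (by omega)) ?_
      rw [show i - 1 + p = i + p - 1 by omega]
      exact hl.resolve_left (by omega)
  · rcases lt_trichotomy j j' with hlt | heq | hlt
    · refine absurd (hper' (j - p + 1) (by omega) (by omega)) (Ne.symm ?_)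
      rw [show j - p + 1 + p = j + 1 by omega]
      exact hr.resolve_left (by omega)
    · exact heq
    · refine absurd (hper (j' - p + 1) (by omega) (by omega)) (Ne.symm ?_)
      rw [show j' - p + 1 + p = j' + 1 by omega]
      exact hr'.resolve_left (by omega)

/-- If the periodicity of a segment of period `p` breaks with a smaller letter, then no Lyndon
substring starting at a root of the segment is longer than `p`. -/
theorem IsLyndon.le_of_period {lt : α → α → Prop} (hasymm : ∀ a b, lt a b → ¬ lt b a)
    {w : ℕ → α} {i j p k e p' : ℕ} (hp : 0 < p) (hper : IsPeriod w i j p)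
    (hk : i ≤ k) (hkj : k + p ≤ j + 1) (hkp' : e + 1 = k + p') (h : IsLyndon lt (substr w k e))
    (hbreak : j < e → lt (w (j + 1)) (w (j + 1 - p))) : p' ≤ p := by
  by_contra! hlt
  obtain ⟨t, ht, heq, hab⟩ := h.exists_mismatch hkp' hp hlt
  by_cases hje : k + p + t ≤ j
  · rw [hper (k + t) (by omega) (by omega), show k + t + p = k + p + t by omega] at hab
    exact hasymm _ _ hab hab
  · have hb := hbreak (by omega)
    obtain ⟨x, hx⟩ : ∃ x, j + 1 = k + p + x := ⟨j + 1 - (k + p), by omega⟩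
    rw [hx, show k + p + x - p = k + x by omega] at hb
    rcases Nat.lt_or_ge x t with hxt | hxt
    · rw [heq x hxt] at hb
      exact hasymm _ _ hb hb
    · obtain rfl : x = t := by omega
      exact hasymm _ _ hb hab

/-- The letter before a root of length at least two exceeds the first letter of the root. -/
theorem IsLyndon.lt_pred {lt : α → α → Prop} {w : ℕ → α} {i j p k e : ℕ}
    (hper : IsPeriod w i j p) (hk : i < k) (hkp : e + 1 = k + p) (hej : e ≤ j) (hp : 1 < p)
    (h : IsLyndon lt (substr w k e)) : lt (w k) (w (k - 1)) := by
  obtain ⟨t, ht, -, hab⟩ := h.exists_mismatch hkp (d := p - 1) (by omega) (by omega)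
  obtain rfl : t = 0 := by omega
  rw [hper (k - 1) (by omega) (by omega), show k - 1 + p = k + (p - 1) by omega]
  exact hab

theorem hatOrd_hat {lt0 lt1 : α → α → Prop} {ℓ : Bool} {w : ℕ → α} {n a b : ℕ} (ha : a ≤ n)
    (hb : b ≤ n) : hatOrd lt0 lt1 ℓ (hat w n a) (hat w n b) ↔ (cond ℓ lt1 lt0) (w a) (w b) := by
  simp [hat, ha, hb, hatOrd, extLT]

/-- The sets of left endpoints of `B_r` are disjoint for distinct runs `r`. -/
theorem Br_disjoint {lt0 lt1 : α → α → Prop} [IsStrictTotalOrder α lt0]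
    (hopp : ∀ a b : α, lt0 a b ↔ lt1 b a) {n : ℕ} {w : ℕ → α} {i j p i' j' p' : ℕ}
    (hr : IsRun w n i j p) (hr' : IsRun w n i' j' p') {q q' : ℕ × ℕ}
    (hq : q ∈ Br lt0 lt1 w n i j p) (hq' : q' ∈ Br lt0 lt1 w n i' j' p') (hqq' : q.1 = q'.1) :
    (i, j, p) = (i', j', p') := by
  obtain ⟨k, e⟩ := q
  obtain ⟨k', e'⟩ := q'
  obtain rfl : k = k' := hqq'
  obtain ⟨ℓ, hord, ⟨hik, hej, hkp, hlyn⟩, hne⟩ := hq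
  obtain ⟨ℓ', hord', ⟨hik', hej', hkp', hlyn'⟩, hne'⟩ := hq'
  dsimp only at *
  have hasymm0 : ∀ a b, lt0 a b → ¬ lt0 b a := fun a b => asymm_of lt0
  have hasymm : ∀ ℓ : Bool, ∀ a b, (cond ℓ lt1 lt0) a b → ¬ (cond ℓ lt1 lt0) b a := by
    rintro (_ | _) a b
    · exact hasymm0 a b
    · simp only [cond_true, ← hopp]
      exact hasymm0 b a
  have ⟨_, hjn, hp, _, hper, _⟩ := hr
  have ⟨_, hjn', hp', _, hper', _⟩ := hr'
  suffices hpp : p = p' by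
    subst hpp
    obtain ⟨rfl, rfl⟩ := hr.eq_of_period_eq hr' (k := k) (by omega) (by omega) (by omega) (by omega)
    rfl
  by_cases hℓ : ℓ = ℓ'
  · subst hℓ
    apply le_antisymm
    · exact hlyn.le_of_period (hasymm ℓ) hp' hper' hik' (by omega) hkp
        fun h => (hatOrd_hat (by omega) (by omega)).1 hord'
    · exact hlyn'.le_of_period (hasymm ℓ) hp hper hik (by omega) hkp'
        fun h => (hatOrd_hat (by omega) (by omega)).1 hord
  · have hlt : 1 < p → _ := fun h => hlyn.lt_pred hper (by omega) hkp hej h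
    have hlt' : 1 < p' → _ := fun h => hlyn'.lt_pred hper' (by omega) hkp' hej' h
    have hpred := hper (k - 1) (by omega) (by omega)
    have hpred' := hper' (k - 1) (by omega) (by omega)
    rcases Nat.lt_or_ge 1 p with h1 | h1 <;> rcases Nat.lt_or_ge 1 p' with h1' | h1'
    · have hl := hlt h1
      have hl' := hlt' h1'
      cases ℓ <;> cases ℓ' <;> simp only [cond_true, cond_false, ← hopp] at hl hl'
      · exact absurd rfl hℓ
      · exact absurd hl (hasymm0 _ _ hl')
      · exact absurd hl (hasymm0 _ _ hl')
      · exact absurd rfl hℓ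
    · obtain rfl : p' = 1 := by omega
      have hl := hlt h1
      rw [hpred', show k - 1 + 1 = k by omega] at hl
      exact absurd hl (hasymm ℓ _ _ hl)
    · obtain rfl : p = 1 := by omega
      have hl := hlt' h1'
      rw [hpred, show k - 1 + 1 = k by omega] at hl
      exact absurd hl (hasymm ℓ' _ _ hl)
    · omega

theorem Br_injOn_fst (lt0 lt1 : α → α → Prop) (w : ℕ → α) (n i j p : ℕ) :
    Set.InjOn Prod.fst (Br lt0 lt1 w n i j p) := by
  rintro ⟨k, e⟩ ⟨-, -, ⟨-, -, h, -⟩, -⟩ ⟨k', e'⟩ ⟨-, -, ⟨-, -, h', -⟩, -⟩ rfl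
  simp only [Prod.mk.injEq, true_and] at *
  omega

theorem IsRun.fst_image_Br_subset (lt0 lt1 : α → α → Prop) {w : ℕ → α} {n i j p : ℕ}
    (h : IsRun w n i j p) : Prod.fst '' Br lt0 lt1 w n i j p ⊆ Set.Icc 2 n := by
  rintro _ ⟨⟨k, e⟩, ⟨-, -, ⟨h1, h2, h3, -⟩, h4⟩, rfl⟩
  obtain ⟨hi, hj, hp, -⟩ := h
  simp only [Set.mem_Icc] at *
  omega

theorem Runs_finite (w : ℕ → α) (n : ℕ) : (Runs w n).Finite := by
  refine ((Set.finite_Iic n).prod ((Set.finite_Iic n).prod (Set.finite_Iic n))).subset ?_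
  rintro ⟨i, j, p⟩ ⟨hi, hj, hp, hlen, -⟩
  simp only [Set.mem_prod, Set.mem_Iic] at *
  omega

theorem runs_stmt4 {α : Type*} (lt0 lt1 : α → α → Prop)
    [IsStrictTotalOrder α lt0]
    (hopp : ∀ a b : α, lt0 a b ↔ lt1 b a)
    (n : ℕ) (w : ℕ → α) :
    (∀ i j p, IsRun w n i j p → (1 : ℕ) ∉ Prod.fst '' Br lt0 lt1 w n i j p) ∧
    ∑ᶠ r ∈ Runs w n, (Br lt0 lt1 w n r.1 r.2.1 r.2.2).ncard ≤ n - 1 := by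
  classical
  refine ⟨fun i j p h h1 => by simpa using h.fst_image_Br_subset lt0 lt1 h1, ?_⟩
  rw [finsum_mem_eq_finite_toFinset_sum _ (Runs_finite w n)]
  let beg (r : ℕ × ℕ × ℕ) : Finset ℕ :=
    {k ∈ Finset.Icc 2 n | k ∈ Prod.fst '' Br lt0 lt1 w n r.1 r.2.1 r.2.2}
  have hcard : ∀ r ∈ (Runs_finite w n).toFinset,
      (Br lt0 lt1 w n r.1 r.2.1 r.2.2).ncard = (beg r).card := by
    intro r hr
    have hrun : IsRun w n r.1 r.2.1 r.2.2 := by simpa [Runs] using hr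
    rw [← (Br_injOn_fst lt0 lt1 w n r.1 r.2.1 r.2.2).ncard_image,
      ← Set.ncard_coe_finset]
    congr 1
    ext k
    simp only [beg, Finset.coe_filter, Finset.mem_Icc, Set.mem_ofPred_eq]
    exact ⟨fun hk => ⟨hrun.fst_image_Br_subset lt0 lt1 hk, hk⟩, And.right⟩
  rw [Finset.sum_congr rfl hcard, ← Finset.card_biUnion]
  · calc _ ≤ (Finset.Icc 2 n).card :=
          Finset.card_le_card (Finset.biUnion_subset.2 fun r _ => Finset.filter_subset _ _)
      _ = n - 1 := by simp
  · intro r hr r' hr' hne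
    rw [Function.onFun, Finset.disjoint_left]
    intro k hk hk'
    obtain ⟨q, hq, rfl⟩ := (Finset.mem_filter.1 hk).2
    obtain ⟨q', hq', hqq'⟩ := (Finset.mem_filter.1 hk').2
    have hrun : IsRun w n r.1 r.2.1 r.2.2 := by simpa [Runs] using hr
    have hrun' : IsRun w n r'.1 r'.2.1 r'.2.2 := by simpa [Runs] using hr'
    exact hne (Br_disjoint hopp hrun hrun' hq hq' hqq'.symm)
end

section
/- For every integer k ≥ 2 and every string w of length n ≥ 1, the number of runs of w with exponent at least k is at most (n−1)/(k−1); in particular, the maximum number ρ_k(n) of runs with exponent at least k in a string of length n satisfies ρ_k(n) < n/(k−1). -/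
variable {α : Type*}

/-- The suffix of `v` at `x` precedes the suffix at `y` lexicographically,
letters being compared with `r`. -/
def SuffixLT {β : Type*} (r : β → β → Prop) (v : ℕ → β) (x y : ℕ) : Prop :=
  ∃ t, (∀ s < t, v (x + s) = v (y + s)) ∧ r (v (x + t)) (v (y + t))

lemma SuffixLT.trans {β : Type*} {r : β → β → Prop} [IsTrans β r] {v : ℕ → β} {x y z : ℕ}
    (hxy : SuffixLT r v x y) (hyz : SuffixLT r v y z) : SuffixLT r v x z := by
  obtain ⟨t, ht, hrt⟩ := hxy
  obtain ⟨u, hu, hru⟩ := hyz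
  rcases lt_trichotomy t u with h | h | h
  · exact ⟨t, fun s hs => (ht s hs).trans (hu s (hs.trans h)), hu t h ▸ hrt⟩
  · subst h
    exact ⟨t, fun s hs => (ht s hs).trans (hu s hs), _root_.trans hrt hru⟩
  · exact ⟨u, fun s hs => (ht s (hs.trans h)).trans (hu s hs), (ht u h).symm ▸ hru⟩

lemma SuffixLT.irrefl {β : Type*} {r : β → β → Prop} [Std.Irrefl r] {v : ℕ → β} {x : ℕ} :
    ¬ SuffixLT r v x x :=
  fun ⟨_, _, h⟩ => irrefl_of r _ h

lemma SuffixLT.swap {β : Type*} {r : β → β → Prop} {v : ℕ → β} {x y : ℕ}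
    (h : SuffixLT r v x y) : SuffixLT (Function.swap r) v y x := by
  obtain ⟨t, ht, hr⟩ := h
  exact ⟨t, fun s hs => (ht s hs).symm, hr⟩

lemma SuffixLT.of_head_eq {β : Type*} {r : β → β → Prop} [Std.Irrefl r] {v : ℕ → β} {x y : ℕ}
    (h : SuffixLT r v x y) (hv : v x = v y) : SuffixLT r v (x + 1) (y + 1) := by
  obtain ⟨t, ht, hr⟩ := h
  cases t with
  | zero => exact (irrefl_of r _ (by simpa [hv] using hr)).elim
  | succ t =>
    refine ⟨t, fun s hs => ?_, ?_⟩
    · have := ht (s + 1) (by omega)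
      rwa [add_comm s, ← add_assoc, ← add_assoc] at this
    · rwa [add_comm t, ← add_assoc, ← add_assoc] at hr

/-- The suffix at `x + p` is the first one after position `x` preceding the suffix at `x`;
equivalently, the longest Lyndon word starting at `x` has length `p`. -/
def IsLyndonFactor {β : Type*} (r : β → β → Prop) (v : ℕ → β) (x p : ℕ) : Prop :=
  (∀ y, x < y → y < x + p → SuffixLT r v x y) ∧ SuffixLT r v (x + p) x

lemma IsLyndonFactor.le {β : Type*} {r : β → β → Prop} [IsStrictOrder β r] {v : ℕ → β}
    {x p q : ℕ} (hp : 1 ≤ p) (h : IsLyndonFactor r v x p) (h' : IsLyndonFactor r v x q) :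
    q ≤ p := by
  by_contra! hlt
  exact SuffixLT.irrefl ((h'.1 (x + p) (by omega) (by omega)).trans h.2)

lemma IsLyndonFactor.first_ne_last {β : Type*} {r : β → β → Prop} [IsStrictOrder β r]
    {v : ℕ → β} {x p : ℕ} (hp : 1 < p) (h : IsLyndonFactor r v x p) :
    v x ≠ v (x + p - 1) := by
  intro hv
  have h1 := (h.1 (x + p - 1) (by omega) (by omega)).of_head_eq hv
  rw [Nat.sub_add_cancel (by omega)] at h1
  exact SuffixLT.irrefl ((h.1 (x + 1) (by omega) (by omega)).trans (h1.trans h.2))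

/-- Among `p` consecutive rotations of a `p`-periodic primitive sequence, one is Lyndon. -/
lemma exists_lyndon_rotation {β : Type*} [LinearOrder β] (V : ℕ → β) (p : ℕ) (hp : 1 ≤ p)
    (hper : ∀ t, V (t + p) = V t)
    (hprim : ∀ q, 1 ≤ q → q < p → ¬ ∀ t, V (t + q) = V t) (a : ℕ) :
    ∃ x, a ≤ x ∧ x < a + p ∧ ∀ y, x < y → y < x + p →
      ∃ t, y + t < x + p ∧ (∀ s < t, V (x + s) = V (y + s)) ∧ V (x + t) < V (y + t) := by
  set R : ℕ → Lex (ℕ → β) := fun x => toLex fun t => V (x + t) with hR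
  have hRp : ∀ x, R (x + p) = R x := fun x => by
    simp only [hR]
    congr 1
    funext t
    rw [add_right_comm, hper]
  obtain ⟨x, hx, hmin⟩ := Finset.exists_min_image (Finset.Ico a (a + p)) R
    ⟨a, by simp; omega⟩
  rw [Finset.mem_Ico] at hx
  have hmin' : ∀ y, x ≤ y → y < x + p → R x ≤ R y := by
    intro y h1 h2
    by_cases h : y < a + p
    · exact hmin y (Finset.mem_Ico.2 ⟨by omega, h⟩)
    · rw [← Nat.sub_add_cancel (show p ≤ y by omega), hRp]
      exact hmin _ (Finset.mem_Ico.2 ⟨by omega, by omega⟩)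
  refine ⟨x, hx.1, hx.2, fun y h1 h2 => ?_⟩
  have hne : R x ≠ R y := by
    intro h
    refine hprim (y - x) (by omega) (by omega) fun t => ?_
    have hmul : ∀ m t, V (t + m * p) = V t := by
      intro m
      induction m with
      | zero => simp
      | succ m ih => intro t; rw [Nat.succ_mul, ← add_assoc, hper, ih]
    have hle : x ≤ x * p := Nat.le_mul_of_pos_right _ hp
    have hV : V (x + (t + x * p - x)) = V (y + (t + x * p - x)) :=
      congrFun (toLex.injective h) (t + x * p - x)
    rw [← hmul x t, ← hmul x (t + (y - x))]
    convert hV.symm using 2 <;> omega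
  obtain ⟨t, ht, hlt⟩ : ∃ t, (∀ s < t, V (x + s) = V (y + s)) ∧ V (x + t) < V (y + t) :=
    lt_of_le_of_ne (hmin' y h1.le h2) hne
  refine ⟨t, ?_, ht, hlt⟩
  by_contra! hle
  set d := x + p - y with hd
  refine absurd (hmin' (x + d) (by omega) (by omega)) (not_le.2 ?_)
  rw [← hRp x, show x + p = y + d by omega]
  refine ⟨t - d, fun s hs => ?_, ?_⟩
  · have := ht (d + s) (by change s < t - d at hs; omega)
    simpa [hR, add_assoc] using this
  · have := hlt
    rw [show t = d + (t - d) by omega] at this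
    simpa only [hR, add_assoc, Pi.toLex_apply] using this

/-- If the letter following a run is smaller than the one expected by periodicity, then any `p`
consecutive positions of the run that leave room for a factor of length `p` contain the start of
a Lyndon root. -/
lemma exists_lyndonFactor_of_run {β : Type*} [LinearOrder β] {v : ℕ → β} {i j p a : ℕ}
    (hp : 1 ≤ p) (hper : IsPeriod v i j p) (hlen : i + 2 * p ≤ j + 1)
    (hprim : ∀ q, 1 ≤ q → q < p → ¬ IsPeriod v i j q)
    (hbreak : v (j + 1) < v (j + 1 - p)) (hia : i ≤ a) (haj : a + 2 * p ≤ j + 2) :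
    ∃ x, a ≤ x ∧ x < a + p ∧ IsLyndonFactor (· < ·) v x p := by
  have hV : ∀ t, i + t ≤ j → v (i + t % p) = v (i + t) := by
    intro t
    induction t using Nat.strong_induction_on with
    | _ t ih =>
      intro ht
      by_cases h : t < p
      · rw [Nat.mod_eq_of_lt h]
      · rw [Nat.mod_eq_sub_mod (by omega), ih (t - p) (by omega) (by omega),
          hper (i + (t - p)) (by omega) (by omega)]
        congr 1
        omega
  obtain ⟨x, hx1, hx2, hx⟩ := exists_lyndon_rotation (fun t => v (i + t % p)) p hp
    (fun t => by simp)
    (fun q hq hqp h => hprim q hq hqp fun k hk hkq => by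
      have := h (k - i)
      rw [hV _ (by omega), hV _ (by omega)] at this
      rw [show k = i + (k - i) by omega, ← this]
      congr 1
      omega) (a - i)
  refine ⟨i + x, by omega, by omega, fun y h1 h2 => ?_, ?_⟩
  · obtain ⟨t, ht, heq, hlt⟩ := hx (y - i) (by omega) (by omega)
    have hy : ∀ s ≤ t, v (i + (x + s) % p) = v (i + x + s) ∧
        v (i + (y - i + s) % p) = v (y + s) := by
      intro s hs
      rw [hV _ (by omega), hV _ (by omega)]
      exact ⟨by rw [add_assoc], by congr 1; omega⟩
    refine ⟨t, fun s hs => ?_, ?_⟩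
    · rw [← (hy s hs.le).1, ← (hy s hs.le).2]
      exact heq s hs
    · rw [← (hy t le_rfl).1, ← (hy t le_rfl).2]
      exact hlt
  · refine ⟨j + 1 - p - (i + x), fun s hs => ?_, ?_⟩
    · rw [hper (i + x + s) (by omega) (by omega), add_right_comm]
    · convert hbreak using 2 <;> omega

/-- A run is determined by its period together with a factor of that length inside it. -/
lemma IsRun.eq_of_overlap {α : Type*} {w : ℕ → α} {n i j i' j' p x : ℕ} (h : IsRun w n i j p)
    (h' : IsRun w n i' j' p) (hi : i ≤ x) (hi' : i' ≤ x) (hj : x + p ≤ j + 1)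
    (hj' : x + p ≤ j' + 1) : i = i' ∧ j = j' := by
  obtain ⟨h1, h2, h3, h4, h5, -, h6, h7⟩ := h
  obtain ⟨g1, g2, -, g4, g5, -, g6, g7⟩ := h'
  refine ⟨le_antisymm (le_of_not_gt fun hlt => ?_) (le_of_not_gt fun hlt => ?_),
    le_antisymm (le_of_not_gt fun hlt => ?_) (le_of_not_gt fun hlt => ?_)⟩
  · refine h6.elim (by omega) fun hne => hne ?_
    rw [g5 (i - 1) (by omega) (by omega)]
    congr 1; omega
  · refine g6.elim (by omega) fun hne => hne ?_
    rw [h5 (i' - 1) (by omega) (by omega)]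
    congr 1; omega
  · refine g7.elim (by omega) fun hne => hne ?_
    rw [h5 (j' - p + 1) (by omega) (by omega)]
    congr 1; omega
  · refine h7.elim (by omega) fun hne => hne ?_
    rw [g5 (j - p + 1) (by omega) (by omega)]
    congr 1; omega

/-- Position `x`, not the first one of the run `(i,j,p)`, starts a Lyndon root of the run
for one of the two opposite orders. -/
def IsRootStart {β : Type*} [LT β] (v : ℕ → β) (i j p x : ℕ) : Prop :=
  i < x ∧ x + p ≤ j + 1 ∧ (IsLyndonFactor (· < ·) v x p ∨ IsLyndonFactor (· > ·) v x p)

lemma IsRun.exists_isRootStart {β : Type*} [LinearOrder β] {v : ℕ → β} {i j p a : ℕ}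
    (hp : 1 ≤ p) (hper : IsPeriod v i j p) (hlen : i + 2 * p ≤ j + 1)
    (hprim : ∀ q, 1 ≤ q → q < p → ¬ IsPeriod v i j q)
    (hbreak : v (j + 1) ≠ v (j + 1 - p)) (hia : i < a) (haj : a + 2 * p ≤ j + 2) :
    ∃ x, a ≤ x ∧ x < a + p ∧ IsRootStart v i j p x := by
  rcases lt_or_gt_of_ne hbreak with h | h
  · obtain ⟨x, h1, h2, hx⟩ := exists_lyndonFactor_of_run hp hper hlen hprim h hia.le haj
    exact ⟨x, h1, h2, by omega, by omega, .inl hx⟩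
  · obtain ⟨x, h1, h2, hx⟩ :=
      exists_lyndonFactor_of_run (β := βᵒᵈ) hp hper hlen hprim h hia.le haj
    exact ⟨x, h1, h2, by omega, by omega, .inr hx⟩

/-- Lyndon roots of two runs for opposite orders do not start at the same position. -/
lemma IsLyndonFactor.not_opposite {β : Type*} [LinearOrder β] {v : ℕ → β}
    {i j p i' j' p' x : ℕ} (hp : 1 ≤ p) (hp' : 1 ≤ p') (hper : IsPeriod v i j p)
    (hper' : IsPeriod v i' j' p') (hi : i < x) (hi' : i' < x) (hj : x + p ≤ j + 1)
    (hj' : x + p' ≤ j' + 1) (h : IsLyndonFactor (· < ·) v x p)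
    (h' : IsLyndonFactor (· > ·) v x p') : False := by
  have e := hper (x - 1) (by omega) (by omega)
  have e' := hper' (x - 1) (by omega) (by omega)
  have irr : ¬ SuffixLT (· < ·) v x x := SuffixLT.irrefl
  rcases eq_or_lt_of_le hp with rfl | h1 <;> rcases eq_or_lt_of_le hp' with rfl | h2
  · exact irr (h'.2.swap.trans h.2)
  · refine h'.first_ne_last h2 ?_
    rw [Nat.sub_add_cancel (by omega)] at e
    rw [← e, e']
    congr 1; omega
  · refine h.first_ne_last h1 ?_
    rw [Nat.sub_add_cancel (by omega)] at e'
    rw [← e', e]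
    congr 1; omega
  · exact irr ((h.1 (x + 1) (by omega) (by omega)).trans
      (h'.1 (x + 1) (by omega) (by omega)).swap)

lemma IsRootStart.period_eq {β : Type*} [LinearOrder β] {v : ℕ → β}
    {i j p i' j' p' x : ℕ} (hp : 1 ≤ p) (hp' : 1 ≤ p') (hper : IsPeriod v i j p)
    (hper' : IsPeriod v i' j' p') (h : IsRootStart v i j p x)
    (h' : IsRootStart v i' j' p' x) : p = p' := by
  obtain ⟨h1, h2, h | h⟩ := h <;> obtain ⟨g1, g2, g | g⟩ := h'
  · exact le_antisymm (g.le hp' h) (h.le hp g)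
  · exact (h.not_opposite hp hp' hper hper' h1 g1 h2 g2 g).elim
  · exact (g.not_opposite hp' hp hper' hper g1 h1 g2 h2 h).elim
  · exact le_antisymm (g.le hp' h) (h.le hp g)

/-- The string `w[1..n]` followed by a letter smaller than all others. -/
def padBot {α : Type*} (w : ℕ → α) (n : ℕ) : ℕ → WithBot α :=
  fun t => if t ≤ n then (w t : WithBot α) else ⊥

lemma isPeriod_padBot_iff {α : Type*} {w : ℕ → α} {n i j p : ℕ} (hj : j ≤ n) :
    IsPeriod (padBot w n) i j p ↔ IsPeriod w i j p := by
  refine forall_congr' fun k => forall_congr' fun _ => forall_congr' fun hk => ?_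
  simp [padBot, show k ≤ n by omega, show k + p ≤ n by omega]

lemma IsRun.padBot_ne {α : Type*} {w : ℕ → α} {n i j p : ℕ} (h : IsRun w n i j p) :
    padBot w n (j + 1) ≠ padBot w n (j + 1 - p) := by
  obtain ⟨h1, h2, h3, h4, -, -, -, h7⟩ := h
  rcases eq_or_ne j n with rfl | hne
  · simp [padBot, show j + 1 - p ≤ j by omega]
  · have := h7.resolve_left hne
    rw [show j - p + 1 = j + 1 - p by omega] at this
    simpa [padBot, show j + 1 - p ≤ n by omega, show j + 1 ≤ n by omega] using this

lemma mul_period_le_of_le_expo {α : Type*} {w : ℕ → α} {n i j p k : ℕ} (h : IsRun w n i j p)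
    (hk : (k : ℚ) ≤ expo (i, j, p)) : i + k * p ≤ j + 1 := by
  have hp : (0 : ℚ) < p := by exact_mod_cast h.2.2.1
  rw [expo, le_div_iff₀ hp] at hk
  have : (i : ℚ) + k * p ≤ j + 1 := by simp only at hk; linarith
  exact_mod_cast this

lemma ncard_runs_mul_le {α : Type*} (k n : ℕ) (w : ℕ → α) :
    {r ∈ Runs w n | (k : ℚ) ≤ expo r}.ncard * (k - 1) ≤ n - 1 := by
  let _ : LinearOrder α := IsWellOrder.linearOrder WellOrderingRel
  set K := {r ∈ Runs w n | (k : ℚ) ≤ expo r} with hK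
  have key : ∀ (r : ℕ × ℕ × ℕ) (m : ℕ), ∃ x, r ∈ K → m < k - 1 →
      r.1 + 1 + m * r.2.2 ≤ x ∧ x < r.1 + 1 + m * r.2.2 + r.2.2 ∧
        IsRootStart (padBot w n) r.1 r.2.1 r.2.2 x := by
    rintro ⟨i, j, p⟩ m
    by_cases h : (i, j, p) ∈ K ∧ m < k - 1
    · obtain ⟨⟨hr, he⟩, hm⟩ := h
      have hr' : IsRun w n i j p := hr
      have hlen := mul_period_le_of_le_expo hr' he
      have hmul : (m + 2) * p ≤ k * p := Nat.mul_le_mul_right _ (by omega)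
      rw [add_mul] at hmul
      obtain ⟨h1, h2, h3, h4, h5, h6, -, -⟩ := id hr'
      obtain ⟨x, hx⟩ := IsRun.exists_isRootStart (a := i + 1 + m * p) h3
        ((isPeriod_padBot_iff h2).2 h5) h4
        (fun q hq hqp => (isPeriod_padBot_iff h2).not.2 (h6 q hq hqp)) hr'.padBot_ne
        (by omega) (by omega)
      exact ⟨x, fun _ _ => hx⟩
    · exact ⟨0, fun h1 h2 => (h ⟨h1, h2⟩).elim⟩
  choose f hf using key
  have hle : (K ×ˢ Set.Iio (k - 1)).ncard ≤ (Set.Icc 2 n).ncard := by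
    refine Set.ncard_le_ncard_of_injOn (fun q => f q.1 q.2) ?_ ?_ (Set.finite_Icc 2 n)
    · rintro ⟨⟨i, j, p⟩, m⟩ ⟨hr, hm⟩
      obtain ⟨-, -, h1, h2, -⟩ := hf _ m hr hm
      obtain ⟨g1, g2, g3, -⟩ : IsRun w n i j p := hr.1
      simp only [Set.mem_Icc] at h1 h2 ⊢
      omega
    · rintro ⟨⟨i, j, p⟩, m⟩ ⟨hr, hm⟩ ⟨⟨i', j', p'⟩, m'⟩ ⟨hr', hm'⟩ heq
      obtain ⟨a1, a2, h⟩ := hf _ m hr hm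
      obtain ⟨b1, b2, h'⟩ := hf _ m' hr' hm'
      have hR : IsRun w n i j p := hr.1
      have hR' : IsRun w n i' j' p' := hr'.1
      simp only at heq a1 a2 b1 b2 h h'
      rw [← heq] at b1 b2 h'
      obtain rfl := h.period_eq hR.2.2.1 hR'.2.2.1
        ((isPeriod_padBot_iff hR.2.1).2 hR.2.2.2.2.1)
        ((isPeriod_padBot_iff hR'.2.1).2 hR'.2.2.2.2.1) h'
      obtain ⟨rfl, rfl⟩ := hR.eq_of_overlap hR' h.1.le h'.1.le h.2.1 h'.2.1
      have e1 : m * p < (m' + 1) * p := by rw [add_mul]; omega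
      have e2 : m' * p < (m + 1) * p := by rw [add_mul]; omega
      have := Nat.lt_of_mul_lt_mul_right e1
      have := Nat.lt_of_mul_lt_mul_right e2
      obtain rfl : m = m' := by omega
      rfl
  rw [Set.ncard_prod] at hle
  simpa [Set.ncard_eq_toFinset_card'] using hle

theorem runs_stmt7 {α : Type*} (k : ℕ) (hk : 2 ≤ k) (n : ℕ) (hn : 1 ≤ n) (w : ℕ → α) :
    (({r ∈ Runs w n | (k : ℚ) ≤ expo r}).ncard : ℚ) ≤ ((n : ℚ) - 1) / ((k : ℚ) - 1) ∧
    (({r ∈ Runs w n | (k : ℚ) ≤ expo r}).ncard : ℚ) < (n : ℚ) / ((k : ℚ) - 1) := by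
  have h := ncard_runs_mul_le k n w
  have hk' : (0 : ℚ) < (k : ℚ) - 1 := by
    have : (2 : ℚ) ≤ k := by exact_mod_cast hk
    linarith
  have hle : (({r ∈ Runs w n | (k : ℚ) ≤ expo r}).ncard : ℚ) * ((k : ℚ) - 1) ≤ (n : ℚ) - 1 := by
    have : (({r ∈ Runs w n | (k : ℚ) ≤ expo r}).ncard : ℚ) * ((k - 1 : ℕ) : ℚ) ≤
        ((n - 1 : ℕ) : ℚ) := by exact_mod_cast h
    rwa [Nat.cast_sub (by omega), Nat.cast_sub hn, Nat.cast_one] at this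
  rw [le_div_iff₀ hk', lt_div_iff₀ hk']
  exact ⟨hle, by linarith⟩
end
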